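/- Let π: M → N be a contact-complex Riemannian submersion whose total space M satisfies the curvature condition K_{1φ}. If the O'Neill tensor T is φ-bilinear (i.e. T_U φV = φ T_U V for all vertical U, V), then every fibre of π, endowed with its induced almost contact metric structure, satisfies K_{1φ}. -/

import Mathlib

/-!
Algebraic (Koszul-style) model of the geometry of a smooth Riemannian manifold:
`C` plays the role of the ring of smooth functions, `V` the `C`-module of smooth
vector fields, `act` the action of vector fields on functions as derivations,
`g` the Riemannian metric, `bracket` the Lie bracket and `nabla` the
Levi-Civita connection (characterized by being metric and torsion-free).
-/
structure RiemData (C V : Type) [CommRing C] [Algebra ℝ C]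
    [AddCommGroup V] [Module C V] where
  act : V → C → C
  g : V → V → C
  bracket : V → V → V
  nabla : V → V → V
  act_add_left : ∀ X Y f, act (X + Y) f = act X f + act Y f
  act_smul_left : ∀ (f : C) (X : V) (k : C), act (f • X) k = f * act X k
  act_add_right : ∀ X f k, act X (f + k) = act X f + act X k
  act_mul_right : ∀ X f k, act X (f * k) = f * act X k + k * act X f
  act_const : ∀ X (r : ℝ), act X ((algebraMap ℝ C) r) = 0
  g_symm : ∀ X Y, g X Y = g Y X
  g_add_left : ∀ X Y Z, g (X + Y) Z = g X Z + g Y Z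
  g_smul_left : ∀ (f : C) X Y, g (f • X) Y = f * g X Y
  bracket_antisymm : ∀ X Y, bracket X Y = - bracket Y X
  bracket_act : ∀ X Y f, act (bracket X Y) f = act X (act Y f) - act Y (act X f)
  nabla_add_left : ∀ X Y Z, nabla (X + Y) Z = nabla X Z + nabla Y Z
  nabla_smul_left : ∀ (f : C) X Y, nabla (f • X) Y = f • nabla X Y
  nabla_add_right : ∀ X Y Z, nabla X (Y + Z) = nabla X Y + nabla X Z
  nabla_smul_right : ∀ (f : C) X Y, nabla X (f • Y) = act X f • Y + f • nabla X Y
  nabla_metric : ∀ X Y Z, act X (g Y Z) = g (nabla X Y) Z + g Y (nabla X Z)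
  nabla_torsion_free : ∀ X Y, nabla X Y - nabla Y X = bracket X Y

namespace RiemData

variable {C V : Type} [CommRing C] [Algebra ℝ C] [AddCommGroup V] [Module C V]
variable (D : RiemData C V)

/-- The curvature operator `R(X,Y)Z = ∇_X∇_Y Z - ∇_Y∇_X Z - ∇_{[X,Y]}Z`. -/
def R (X Y Z : V) : V :=
  D.nabla X (D.nabla Y Z) - D.nabla Y (D.nabla X Z) - D.nabla (D.bracket X Y) Z

/-- The `(0,4)` Riemann curvature tensor `R(X,Y,Z,W) = g(R(X,Y)Z, W)`. -/
def Rm (X Y Z W : V) : C := D.g (D.R X Y Z) W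

/-- Covariant derivative of a `2`-form (`(0,2)`-tensor). -/
def cov2 (ω : V → V → C) (X Y Z : V) : C :=
  D.act X (ω Y Z) - ω (D.nabla X Y) Z - ω Y (D.nabla X Z)

/-- Covariant derivative of a `3`-form (`(0,3)`-tensor). -/
def cov3 (ω : V → V → V → C) (X Y Z W : V) : C :=
  D.act X (ω Y Z W) - ω (D.nabla X Y) Z W - ω Y (D.nabla X Z) W - ω Y Z (D.nabla X W)

/-- A family of vector fields is an orthonormal frame. -/
def Orthonormal {ι : Type} [DecidableEq ι] (e : ι → V) : Prop :=
  ∀ i j, D.g (e i) (e j) = if i = j then (1 : C) else 0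

/-- The codifferential of a `2`-form evaluated on a vector field, computed as the
metric trace of the covariant derivative in the orthonormal frame `e`:
`(δω)(X) = -∑ᵢ (∇_{eᵢ} ω)(eᵢ, X)`. -/
def codiff2 {ι : Type} [Fintype ι] (e : ι → V) (ω : V → V → C) (X : V) : C :=
  -∑ i, D.cov2 ω (e i) (e i) X

/-- The codifferential of a `3`-form, `(δω)(Y,Z) = -∑ᵢ (∇_{eᵢ} ω)(eᵢ, Y, Z)`. -/
def codiff3 {ι : Type} [Fintype ι] (e : ι → V) (ω : V → V → V → C) (Y Z : V) : C :=
  -∑ i, D.cov3 ω (e i) (e i) Y Z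

/-- Exterior differential of a `1`-form. -/
def d1 (θ : V → C) (X Y : V) : C :=
  D.act X (θ Y) - D.act Y (θ X) - θ (D.bracket X Y)

/-- Exterior differential of a `2`-form. -/
def d2 (ω : V → V → C) (X Y Z : V) : C :=
  D.act X (ω Y Z) - D.act Y (ω X Z) + D.act Z (ω X Y)
    - ω (D.bracket X Y) Z + ω (D.bracket X Z) Y - ω (D.bracket Y Z) X

end RiemData

/-- An almost contact metric structure `(φ, ξ, η, g)` on top of the Riemannian data:
`φ² = -I + η ⊗ ξ`, `η(ξ) = 1`, `g(φX, φY) = g(X,Y) - η(X)η(Y)`, `η(X) = g(X,ξ)`. -/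
structure ACMData (C V : Type) [CommRing C] [Algebra ℝ C]
    [AddCommGroup V] [Module C V] extends RiemData C V where
  phi : V → V
  xi : V
  eta : V → C
  phi_add : ∀ X Y, phi (X + Y) = phi X + phi Y
  phi_smul : ∀ (f : C) X, phi (f • X) = f • phi X
  eta_eq : ∀ X, eta X = g X xi
  phi_phi : ∀ X, phi (phi X) = -X + eta X • xi
  eta_xi : eta xi = 1
  g_phi : ∀ X Y, g (phi X) (phi Y) = g X Y - eta X * eta Y

namespace ACMData

variable {C V : Type} [CommRing C] [Algebra ℝ C] [AddCommGroup V] [Module C V]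
variable (D : ACMData C V)

/-- The fundamental `2`-form `Φ(X,Y) = g(X, φY)`. -/
def Phi (X Y : V) : C := D.g X (D.phi Y)

/-- The tensor `A* X = -∇_X ξ` of Olszak. -/
def Astar (X : V) : V := -D.nabla X D.xi

/-- Gray-type curvature condition `K_{1φ}`: `R(X,Y,Z,W) = R(X,Y,φZ,φW)`. -/
def K1phi : Prop :=
  ∀ X Y Z W : V, D.toRiemData.Rm X Y Z W = D.toRiemData.Rm X Y (D.phi Z) (D.phi W)

/-- Gray-type curvature condition `K_{2φ}`. -/
def K2phi : Prop :=
  ∀ X Y Z W : V, D.toRiemData.Rm X Y Z W =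
    D.toRiemData.Rm (D.phi X) Y Z (D.phi W) + D.toRiemData.Rm X (D.phi Y) Z (D.phi W)
      + D.toRiemData.Rm X Y (D.phi Z) (D.phi W)

/-- Gray-type curvature condition `K_{3φ}`: `R(X,Y,Z,W) = R(φX,φY,φZ,φW)`. -/
def K3phi : Prop :=
  ∀ X Y Z W : V, D.toRiemData.Rm X Y Z W =
    D.toRiemData.Rm (D.phi X) (D.phi Y) (D.phi Z) (D.phi W)

/-- `M` is almost cosymplectic when `dΦ = 0` and `dη = 0`. -/
def AlmostCosymplectic : Prop :=
  (∀ X Y Z : V, D.toRiemData.d2 D.Phi X Y Z = 0) ∧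
    (∀ X Y : V, D.toRiemData.d1 D.eta X Y = 0)

/-- Olszak's characterization of almost cosymplectic manifolds with Kähler leaves:
`(∇_X φ)Y = -g(φ A* X, Y) ξ + η(Y) φ A* X`. -/
def KahlerLeaves : Prop :=
  ∀ X Y : V, D.nabla X (D.phi Y) - D.phi (D.nabla X Y) =
    -(D.g (D.phi (D.Astar X)) Y) • D.xi + D.eta Y • D.phi (D.Astar X)

/-- The normality tensor `N₁(X,Y) = [φ,φ](X,Y) + 2 dη(X,Y) ξ`. -/
def N1 (X Y : V) : V :=
  D.phi (D.phi (D.bracket X Y)) + D.bracket (D.phi X) (D.phi Y)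
    - D.phi (D.bracket (D.phi X) Y) - D.phi (D.bracket X (D.phi Y))
    + (2 * D.toRiemData.d1 D.eta X Y) • D.xi

/-- `N₂(X,Y) = (L_{φX} η)Y - (L_{φY} η)X`. -/
def N2 (X Y : V) : C :=
  (D.act (D.phi X) (D.eta Y) - D.eta (D.bracket (D.phi X) Y))
    - (D.act (D.phi Y) (D.eta X) - D.eta (D.bracket (D.phi Y) X))

/-- `N₃(X) = (L_ξ φ)X = [ξ, φX] - φ[ξ, X]`. -/
def N3 (X : V) : V := D.bracket D.xi (D.phi X) - D.phi (D.bracket D.xi X)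

/-- `N₄(X) = (L_ξ η)X = ξ(η(X)) - η([ξ,X])`. -/
def N4 (X : V) : C := D.act D.xi (D.eta X) - D.eta (D.bracket D.xi X)

/-- `M` is cosymplectic when it is almost cosymplectic and normal (`N₁ = 0`). -/
def Cosymplectic : Prop := D.AlmostCosymplectic ∧ ∀ X Y : V, D.N1 X Y = 0

/-- A `φ`-adapted frame `{eᵢ, φeᵢ, ξ}` built from the family `e`. -/
def phiFrame {m : ℕ} (e : Fin m → V) : (Fin m ⊕ Fin m ⊕ Unit) → V :=
  Sum.elim e (Sum.elim (fun i => D.phi (e i)) (fun _ => D.xi))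

end ACMData

/-- An almost Hermitian structure `(J, g')`: `J² = -I` and `g'(JX, JY) = g'(X,Y)`. -/
structure AHData (C V : Type) [CommRing C] [Algebra ℝ C]
    [AddCommGroup V] [Module C V] extends RiemData C V where
  J : V → V
  J_add : ∀ X Y, J (X + Y) = J X + J Y
  J_smul : ∀ (f : C) X, J (f • X) = f • J X
  J_J : ∀ X, J (J X) = -X
  g_J : ∀ X Y, g (J X) (J Y) = g X Y

namespace AHData

variable {C V : Type} [CommRing C] [Algebra ℝ C] [AddCommGroup V] [Module C V]
variable (D : AHData C V)

/-- The fundamental (Kähler) `2`-form `Ω(X,Y) = g(X, JY)`. -/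
def Omega (X Y : V) : C := D.g X (D.J Y)

/-- Gray's first curvature condition `K₁`: `R(X,Y,Z,W) = R(X,Y,JZ,JW)`. -/
def K1 : Prop :=
  ∀ X Y Z W : V, D.toRiemData.Rm X Y Z W = D.toRiemData.Rm X Y (D.J Z) (D.J W)

/-- `N` is Kähler when `∇'J = 0`. -/
def Kahler : Prop := ∀ X Y : V, D.nabla X (D.J Y) = D.J (D.nabla X Y)

/-- A `J`-adapted frame `{eᵢ, Jeᵢ}` built from the family `e`. -/
def JFrame {n : ℕ} (e : Fin n → V) : (Fin n ⊕ Fin n) → V :=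
  Sum.elim e (fun i => D.J (e i))

end AHData

/-- A contact-complex Riemannian submersion `π : M → N` from an almost contact
metric manifold `M` onto an almost Hermitian manifold `N`, described algebraically:
`pull = π^*` on functions, `rel X X'` means that the vector field `X` on `M` is
`π`-related to `X'` on `N` (`dπ ∘ X = X' ∘ π`), `hor` and `ver` are the orthogonal
projections onto the horizontal distribution `H = (ker dπ)^⊥` and the vertical
distribution `V = ker dπ`.  The submersion is Riemannian (`isometry`) and
`(φ,J)`-holomorphic (`rel_phi`); both distributions are `φ`-invariant and `ξ` is
vertical. -/
structure CCSub (C V C' V' : Type) [CommRing C] [Algebra ℝ C] [AddCommGroup V]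
    [Module C V] [CommRing C'] [Algebra ℝ C'] [AddCommGroup V'] [Module C' V'] where
  M : ACMData C V
  N : AHData C' V'
  pull : C' →+* C
  pull_algebraMap : ∀ r : ℝ, pull ((algebraMap ℝ C') r) = (algebraMap ℝ C) r
  rel : V → V' → Prop
  hor : V → V
  ver : V → V
  hor_add : ∀ X Y, hor (X + Y) = hor X + hor Y
  hor_smul : ∀ (f : C) X, hor (f • X) = f • hor X
  ver_add : ∀ X Y, ver (X + Y) = ver X + ver Y
  ver_smul : ∀ (f : C) X, ver (f • X) = f • ver X
  hor_add_ver : ∀ X, hor X + ver X = X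
  hor_hor : ∀ X, hor (hor X) = hor X
  ver_ver : ∀ X, ver (ver X) = ver X
  hor_ver : ∀ X, hor (ver X) = 0
  ver_hor : ∀ X, ver (hor X) = 0
  g_hor_ver : ∀ X Y, M.g (hor X) (ver Y) = 0
  ver_iff_rel_zero : ∀ X, ver X = X ↔ rel X 0
  rel_add : ∀ {X X' Y Y'}, rel X X' → rel Y Y' → rel (X + Y) (X' + Y')
  rel_smul : ∀ {X X'} (f' : C'), rel X X' → rel (pull f' • X) (f' • X')
  rel_bracket : ∀ {X X' Y Y'}, rel X X' → rel Y Y' → rel (M.bracket X Y) (N.bracket X' Y')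
  rel_act : ∀ {X X'} (f' : C'), rel X X' → M.act X (pull f') = pull (N.act X' f')
  rel_unique : ∀ {X X' Y'}, rel X X' → rel X Y' → X' = Y'
  lift_basic : ∀ X' : V', ∃ X : V, hor X = X ∧ rel X X'
  isometry : ∀ {X X' Y Y'}, rel X X' → rel Y Y' → hor X = X → hor Y = Y →
    M.g X Y = pull (N.g X' Y')
  rel_hor_nabla : ∀ {X X' Y Y'}, rel X X' → rel Y Y' → hor X = X → hor Y = Y →
    rel (hor (M.nabla X Y)) (N.nabla X' Y')
  rel_phi : ∀ {X X'}, rel X X' → rel (M.phi X) (N.J X')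
  hor_phi : ∀ X, hor (M.phi (hor X)) = M.phi (hor X)
  ver_phi : ∀ X, ver (M.phi (ver X)) = M.phi (ver X)
  xi_vertical : ver M.xi = M.xi

namespace CCSub

variable {C V C' V' : Type} [CommRing C] [Algebra ℝ C] [AddCommGroup V] [Module C V]
  [CommRing C'] [Algebra ℝ C'] [AddCommGroup V'] [Module C' V']
variable (S : CCSub C V C' V')

/-- A vector field on `M` is basic when it is horizontal and `π`-related to some
vector field on `N`. -/
def Basic (X : V) : Prop := S.hor X = X ∧ ∃ X' : V', S.rel X X'

/-- O'Neill's tensor `T`: `T_E F = h∇_{vE} vF + v∇_{vE} hF`. -/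
def T (E F : V) : V :=
  S.hor (S.M.nabla (S.ver E) (S.ver F)) + S.ver (S.M.nabla (S.ver E) (S.hor F))

/-- O'Neill's tensor `A`: `A_E F = v∇_{hE} hF + h∇_{hE} vF`. -/
def A (E F : V) : V :=
  S.ver (S.M.nabla (S.hor E) (S.hor F)) + S.hor (S.M.nabla (S.hor E) (S.ver F))

/-- The tensor `B` of a contact-complex Riemannian submersion:
`B(E,F) = v∇_{hE} φhF - v∇_{φhE} hF + h∇_{hE} φvF - h∇_{φhE} vF`. -/
def B (E F : V) : V :=
  S.ver (S.M.nabla (S.hor E) (S.M.phi (S.hor F)))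
    - S.ver (S.M.nabla (S.M.phi (S.hor E)) (S.hor F))
    + S.hor (S.M.nabla (S.hor E) (S.M.phi (S.ver F)))
    - S.hor (S.M.nabla (S.M.phi (S.hor E)) (S.ver F))

/-- The curvature of a fibre (a `φ`-invariant submanifold), computed via the Gauss
induced connection `∇̂_U W = v∇_U W` for vertical fields. -/
def fibR (U W F : V) : V :=
  S.ver (S.M.nabla U (S.ver (S.M.nabla W F)))
    - S.ver (S.M.nabla W (S.ver (S.M.nabla U F)))
    - S.ver (S.M.nabla (S.M.bracket U W) F)

/-- Covariant derivative of a `2`-form along the fibres, using the induced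
connection `∇̂_U W = v∇_U W`. -/
def fibCov2 (ω : V → V → C) (U W F : V) : C :=
  S.M.act U (ω W F) - ω (S.ver (S.M.nabla U W)) F - ω W (S.ver (S.M.nabla U F))

/-- Codifferential on a fibre (with the induced metric) of a `2`-form, computed in
a vertical orthonormal frame `e`. -/
def fibCodiff2 {ι : Type} [Fintype ι] (e : ι → V) (ω : V → V → C) (F : V) : C :=
  -∑ i, S.fibCov2 ω (e i) (e i) F

/-- The vertical `φ`-adapted frame `{V_j, φV_j, ξ}`. -/
def vertFrame {p : ℕ} (Vf : Fin p → V) : (Fin p ⊕ Fin p ⊕ Unit) → V :=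
  Sum.elim Vf (Sum.elim (fun j => S.M.phi (Vf j)) (fun _ => S.M.xi))

/-- The `φ`-adapted frame `{Xᵢ, φXᵢ, V_j, φV_j, ξ}` of the total space, with
`Xᵢ` basic and `V_j` vertical. -/
def adaptedFrame {n p : ℕ} (Xb : Fin n → V) (Vf : Fin p → V) :
    ((Fin n ⊕ Fin n) ⊕ (Fin p ⊕ Fin p ⊕ Unit)) → V :=
  Sum.elim (Sum.elim Xb (fun i => S.M.phi (Xb i))) (S.vertFrame Vf)

/-- The mean curvature vector field of the fibres, i.e. the horizontal trace
`H = ∑ h∇_{e_j} e_j` over the vertical frame `{V_j, φV_j, ξ}`. -/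
def meanCurv {p : ℕ} (Vf : Fin p → V) : V :=
  (∑ j, S.hor (S.M.nabla (Vf j) (Vf j)))
    + (∑ j, S.hor (S.M.nabla (S.M.phi (Vf j)) (S.M.phi (Vf j))))
    + S.hor (S.M.nabla S.M.xi S.M.xi)

/-- The trace `Tr B^h` of the restriction of `B` to the horizontal distribution,
computed in the horizontal frame `{Xᵢ, φXᵢ}`. -/
def trBh {n : ℕ} (Xb : Fin n → V) : V :=
  (∑ i, S.B (Xb i) (Xb i)) + (∑ i, S.B (S.M.phi (Xb i)) (S.M.phi (Xb i)))

end CCSub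

variable {C V C' V' : Type} [CommRing C] [Algebra ℝ C] [AddCommGroup V] [Module C V]
  [CommRing C'] [Algebra ℝ C'] [AddCommGroup V'] [Module C' V']

namespace RiemData

variable (D : RiemData C V)

theorem g_add_right (X Y Z : V) : D.g X (Y + Z) = D.g X Y + D.g X Z := by
  rw [D.g_symm, D.g_add_left, D.g_symm Y, D.g_symm Z]

theorem g_sub_left (X Y Z : V) : D.g (X - Y) Z = D.g X Z - D.g Y Z := by
  rw [eq_sub_iff_add_eq, ← D.g_add_left, sub_add_cancel]

theorem act_zero_right (X : V) : D.act X 0 = 0 := by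
  simpa using D.act_const X 0

theorem nabla_zero_right (X : V) : D.nabla X 0 = 0 := by
  simpa using D.nabla_add_right X 0 0

end RiemData

namespace CCSub

variable (S : CCSub C V C' V')

theorem ver_zero : S.ver 0 = 0 := by
  simpa using S.ver_add 0 0

theorem hor_eq_zero {U : V} (hU : S.ver U = U) : S.hor U = 0 := by
  rw [← hU, S.hor_ver]

theorem ver_phi_of_ver {U : V} (hU : S.ver U = U) : S.ver (S.M.phi U) = S.M.phi U := by
  rw [← hU, S.ver_phi]

theorem g_hor_of_ver (X : V) {U : V} (hU : S.ver U = U) : S.M.g (S.hor X) U = 0 := by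
  rw [← hU, S.g_hor_ver]

theorem g_ver_of_ver (X : V) {U : V} (hU : S.ver U = U) :
    S.M.g (S.ver X) U = S.M.g X U := by
  conv_rhs => rw [← S.hor_add_ver X, S.M.g_add_left, S.g_hor_of_ver X hU, zero_add]

theorem g_hor_eq_g_hor_hor (X Y : V) :
    S.M.g (S.hor X) Y = S.M.g (S.hor X) (S.hor Y) := by
  conv_lhs => rw [← S.hor_add_ver Y, S.M.g_add_right, S.g_hor_ver, add_zero]

theorem g_phi_hor_phi_hor (X Y : V) :
    S.M.g (S.M.phi (S.hor X)) (S.M.phi (S.hor Y)) = S.M.g (S.hor X) (S.hor Y) := by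
  rw [S.M.g_phi, S.M.eta_eq, S.g_hor_of_ver X S.xi_vertical, zero_mul, sub_zero]

/-- On vertical fields `T` is the second fundamental form of the fibres. -/
theorem T_of_ver {U W : V} (hU : S.ver U = U) (hW : S.ver W = W) :
    S.T U W = S.hor (S.M.nabla U W) := by
  rw [T, hU, hW, S.hor_eq_zero hW, S.M.nabla_zero_right, S.ver_zero, add_zero]

theorem g_nabla_ver_nabla (U W F : V) {G : V} (hG : S.ver G = G) :
    S.M.g (S.M.nabla U (S.ver (S.M.nabla W F))) G =
      S.M.g (S.M.nabla U (S.M.nabla W F)) G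
        + S.M.g (S.hor (S.M.nabla W F)) (S.hor (S.M.nabla U G)) := by
  have hsplit := congrArg (fun X => S.M.g (S.M.nabla U X) G) (S.hor_add_ver (S.M.nabla W F))
  have hmetric := S.M.nabla_metric U (S.hor (S.M.nabla W F)) G
  simp only [S.M.nabla_add_right, S.M.g_add_left] at hsplit
  rw [S.g_hor_of_ver _ hG, S.M.act_zero_right, S.g_hor_eq_g_hor_hor] at hmetric
  linear_combination hsplit + hmetric

/-- The Gauss equation for the fibres. -/
theorem g_fibR (U W F : V) {G : V} (hG : S.ver G = G) :
    S.M.g (S.fibR U W F) G = S.M.Rm U W F G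
      + S.M.g (S.hor (S.M.nabla W F)) (S.hor (S.M.nabla U G))
      - S.M.g (S.hor (S.M.nabla U F)) (S.hor (S.M.nabla W G)) := by
  simp only [fibR, RiemData.Rm, RiemData.R, S.M.g_sub_left, S.g_ver_of_ver _ hG,
    S.g_nabla_ver_nabla _ _ _ hG]
  ring

end CCSub

/-- If the total space `M` of a contact-complex Riemannian
submersion satisfies `K_{1φ}` and the O'Neill tensor `T` is `φ`-bilinear
(`T_U φV = φ T_U V` for vertical `U, V`), then the fibres (with their induced
almost contact metric structure, whose curvature is the Gauss curvature `fibR`)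
satisfy `K_{1φ}`. -/
theorem fibres_K1phi (S : CCSub C V C' V')
    (hK : S.M.K1phi)
    (hT : ∀ U W : V, S.ver U = U → S.ver W = W →
      S.T U (S.M.phi W) = S.M.phi (S.T U W)) :
    ∀ U W F G : V, S.ver U = U → S.ver W = W → S.ver F = F → S.ver G = G →
      S.M.g (S.fibR U W F) G = S.M.g (S.fibR U W (S.M.phi F)) (S.M.phi G) := by
  intro U W F G hU hW hF hG
  have hor_nabla_phi {X Y : V} (hX : S.ver X = X) (hY : S.ver Y = Y) :
      S.hor (S.M.nabla X (S.M.phi Y)) = S.M.phi (S.hor (S.M.nabla X Y)) := by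
    rw [← S.T_of_ver hX (S.ver_phi_of_ver hY), ← S.T_of_ver hX hY, hT X Y hX hY]
  rw [S.g_fibR U W F hG, S.g_fibR U W (S.M.phi F) (S.ver_phi_of_ver hG), hK U W F G,
    hor_nabla_phi hW hF, hor_nabla_phi hU hG, hor_nabla_phi hU hF, hor_nabla_phi hW hG,
    S.g_phi_hor_phi_hor, S.g_phi_hor_phi_hor]
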